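/- arXiv:1906.02578 — 7 statements merged into one kernel-verified Lean document; each statement's English description precedes it below -/
import Mathlib

section
/- If S is a k-plex and v ∈ AddSet(S), i.e. v ∈ N(S), |N(v)∩S| > |S|−k, and C[S]∖N(v) = ∅, then S ∪ {v} is a k-plex. -/
/-- `S` is a `k`-plex of the graph `G`. -/
def IsKPlex {V : Type*} [Fintype V] [DecidableEq V] (G : SimpleGraph V)
    [DecidableRel G.Adj] (k : ℤ) (S : Finset V) : Prop :=
  ∀ v ∈ S, ((S.filter (G.Adj v)).card : ℤ) ≥ (S.card : ℤ) - k

/-- `N(S)`, the set of neighbors of the set `S` (outside of `S`). -/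
def nbrSet {V : Type*} [Fintype V] [DecidableEq V] (G : SimpleGraph V)
    [DecidableRel G.Adj] (S : Finset V) : Finset V :=
  (S.biUnion fun v => G.neighborFinset v) \ S

/-- `C[S]`, the set of saturated vertices of `S`. -/
def satSet {V : Type*} [Fintype V] [DecidableEq V] (G : SimpleGraph V)
    [DecidableRel G.Adj] (k : ℤ) (S : Finset V) : Finset V :=
  S.filter fun v => ((S.filter (G.Adj v)).card : ℤ) = (S.card : ℤ) - k

/-- `AddSet(S)`. -/
def addSet {V : Type*} [Fintype V] [DecidableEq V] (G : SimpleGraph V)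
    [DecidableRel G.Adj] (k : ℤ) (S : Finset V) : Finset V :=
  (nbrSet G S).filter fun v =>
    ((S.filter (G.Adj v)).card : ℤ) > (S.card : ℤ) - k ∧
      satSet G k S \ G.neighborFinset v = ∅

/-- Adding a vertex of `AddSet(S)` to a `k`-plex `S` yields a `k`-plex. -/
theorem insert_addSet_kplex {V : Type*} [Fintype V] [DecidableEq V]
    (G : SimpleGraph V) [DecidableRel G.Adj] (k : ℤ) (hk : 1 ≤ k)
    (S : Finset V) (hS : IsKPlex G k S) (v : V) (hv : v ∈ addSet G k S) :
    IsKPlex G k (insert v S) := by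
  simp only [addSet, nbrSet, Finset.mem_filter, Finset.mem_sdiff] at hv
  obtain ⟨⟨-, hvS⟩, hcard, hsat⟩ := hv
  rw [Finset.sdiff_eq_empty_iff_subset] at hsat
  intro u hu
  rw [Finset.card_insert_of_notMem hvS, Finset.filter_insert]
  push_cast
  rcases Finset.mem_insert.mp hu with rfl | huS
  · rw [if_neg G.irrefl]
    omega
  · have huk := hS u huS
    split_ifs with huv
    · rw [Finset.card_insert_of_notMem fun h => hvS (Finset.mem_filter.mp h).1]
      push_cast
      omega
    · have hne : ((S.filter (G.Adj u)).card : ℤ) ≠ (S.card : ℤ) - k := fun h =>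
        huv ((G.mem_neighborFinset v u).mp (hsat (Finset.mem_filter.mpr ⟨huS, h⟩))).symm
      omega
end

section
/- If S is a k-plex, v ∈ N(S), and S ∪ {v} is also a k-plex, then |N(v)∩S| > |S|−k and C[S]∖N(v) = ∅ (i.e. every saturated vertex of S is a neighbor of v); consequently, for v ∈ N(S), the set S ∪ {v} is a k-plex if and only if v ∈ AddSet(S). -/
/-- Adding `v ∉ S` raises the number of neighbors of `u` by one exactly when `u` and `v` are
adjacent. -/
theorem card_filter_adj_insert {V : Type*} [DecidableEq V] (G : SimpleGraph V)
    [DecidableRel G.Adj] {S : Finset V} {v : V} (hv : v ∉ S) (u : V) :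
    ((insert v S).filter (G.Adj u)).card =
      (S.filter (G.Adj u)).card + if G.Adj u v then 1 else 0 := by
  rw [Finset.filter_insert]
  split_ifs
  · exact Finset.card_insert_of_notMem fun h => hv (Finset.mem_filter.mp h).1
  · rfl

/-- A `k`-plex `S` extends by `v ∉ S` iff `v` has more than `|S| - k` neighbors in `S` and is
adjacent to every saturated vertex of `S`. -/
theorem IsKPlex.insert_iff {V : Type*} [Fintype V] [DecidableEq V] {G : SimpleGraph V}
    [DecidableRel G.Adj] {k : ℤ} {S : Finset V} (hS : IsKPlex G k S) {v : V} (hv : v ∉ S) :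
    IsKPlex G k (insert v S) ↔
      ((S.filter (G.Adj v)).card : ℤ) > (S.card : ℤ) - k ∧
        satSet G k S \ G.neighborFinset v = ∅ := by
  rw [Finset.sdiff_eq_empty_iff_subset]
  simp only [IsKPlex, Finset.forall_mem_insert, card_filter_adj_insert G hv,
    Finset.card_insert_of_notMem hv, SimpleGraph.irrefl, if_false]
  refine and_congr (by push_cast; omega) ⟨fun h u hu => ?_, fun h u hu => ?_⟩
  · obtain ⟨huS, hsat⟩ := Finset.mem_filter.mp hu
    have hdeg := h u huS
    rw [SimpleGraph.mem_neighborFinset]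
    by_contra hvu
    rw [if_neg fun huv => hvu huv.symm] at hdeg
    push_cast at hdeg
    omega
  · have hdeg := hS u hu
    split_ifs with huv
    · push_cast
      omega
    · have hne : ((S.filter (G.Adj u)).card : ℤ) ≠ (S.card : ℤ) - k := fun hsat =>
        huv ((G.mem_neighborFinset v u).mp (h (Finset.mem_filter.mpr ⟨hu, hsat⟩))).symm
      push_cast
      omega

/-- If `S` is a `k`-plex, `v ∈ N(S)` and `S ∪ {v}` is a `k`-plex, then
`|N(v) ∩ S| > |S| - k` and every saturated vertex of `S` is a neighbor of `v`;
consequently, for `v ∈ N(S)`, `S ∪ {v}` is a `k`-plex iff `v ∈ AddSet(S)`. -/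
theorem insert_kplex_iff_addSet {V : Type*} [Fintype V] [DecidableEq V]
    (G : SimpleGraph V) [DecidableRel G.Adj] (k : ℤ) (hk : 1 ≤ k)
    (S : Finset V) (hS : IsKPlex G k S) (v : V) (hv : v ∈ nbrSet G S) :
    (IsKPlex G k (insert v S) →
      ((S.filter (G.Adj v)).card : ℤ) > (S.card : ℤ) - k ∧
        satSet G k S \ G.neighborFinset v = ∅) ∧
    (IsKPlex G k (insert v S) ↔ v ∈ addSet G k S) := by
  have key := hS.insert_iff (Finset.mem_sdiff.mp hv).2
  exact ⟨key.mp, key.trans (by simp only [addSet, Finset.mem_filter, hv, true_and])⟩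
end

section
/- If S is a k-plex, v ∈ N(S) satisfies |N(v)∩S| ≥ |S|−k, and C[S]∖N(v) = {u} for a single vertex u, then (S ∖ {u}) ∪ {v} is a k-plex of the same cardinality as S. -/
/-- Swapping `v` for the unique saturated non-neighbor `u` preserves the
`k`-plex property and the cardinality. -/
theorem swap_single_saturated_nonneighbor {V : Type*} [Fintype V] [DecidableEq V]
    (G : SimpleGraph V) [DecidableRel G.Adj] (k : ℤ) (hk : 1 ≤ k)
    (S : Finset V) (hS : IsKPlex G k S) (v u : V) (hv : v ∈ nbrSet G S)
    (hdeg : ((S.filter (G.Adj v)).card : ℤ) ≥ (S.card : ℤ) - k)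
    (hsat : satSet G k S \ G.neighborFinset v = {u}) :
    IsKPlex G k (insert v (S.erase u)) ∧
      (insert v (S.erase u)).card = S.card := by
  simp only [nbrSet, Finset.mem_sdiff] at hv
  have hmem (w : V) : (w ∈ S ∧ ((S.filter (G.Adj w)).card : ℤ) = (S.card : ℤ) - k) ∧
      ¬ G.Adj v w ↔ w = u := by
    simpa [satSet] using Finset.ext_iff.mp hsat w
  obtain ⟨⟨huS, -⟩, huv⟩ := (hmem u).mpr rfl
  have hcard : (insert v (S.erase u)).card = S.card := by
    rw [Finset.card_insert_of_notMem fun h => hv.2 (Finset.mem_of_mem_erase h),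
      Finset.card_erase_add_one huS]
  refine ⟨fun w hw => ?_, hcard⟩
  rw [hcard, Finset.filter_insert, Finset.filter_erase]
  obtain rfl | hw := Finset.mem_insert.mp hw
  · rwa [if_neg (G.loopless.irrefl w), Finset.erase_eq_of_notMem (by simp [huv])]
  obtain ⟨hwu, hwS⟩ := Finset.mem_erase.mp hw
  have hle := Finset.pred_card_le_card_erase (s := S.filter (G.Adj w)) (a := u)
  have hwdeg := hS w hwS
  split_ifs with hwv
  · rw [Finset.card_insert_of_notMem (by simp [hv.2])]
    omega
  · have hunsat : ((S.filter (G.Adj w)).card : ℤ) ≠ (S.card : ℤ) - k := fun h =>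
      hwu ((hmem w).mp ⟨⟨hwS, h⟩, fun h' => hwv h'.symm⟩)
    omega
end

section
/- If S is a k-plex with k ≥ 1, v ∈ N(S) satisfies |N(v)∩S| = |S|−k and C[S]∖N(v) = ∅, then S∖N(v) is nonempty, and for every u ∈ S∖N(v) the set (S ∖ {u}) ∪ {v} is a k-plex of the same cardinality as S. -/
/-- If `|N(v) ∩ S| = |S| - k` and every saturated vertex of `S` is a neighbor
of `v`, then `S ∖ N(v)` is nonempty and swapping `v` for any `u ∈ S ∖ N(v)`
preserves the `k`-plex property and the cardinality. -/
theorem swap_saturated_neighbors_all {V : Type*} [Fintype V] [DecidableEq V]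
    (G : SimpleGraph V) [DecidableRel G.Adj] (k : ℤ) (hk : 1 ≤ k)
    (S : Finset V) (hS : IsKPlex G k S) (v : V) (hv : v ∈ nbrSet G S)
    (hdeg : ((S.filter (G.Adj v)).card : ℤ) = (S.card : ℤ) - k)
    (hsat : satSet G k S \ G.neighborFinset v = ∅) :
    (S \ G.neighborFinset v).Nonempty ∧
      ∀ u ∈ S \ G.neighborFinset v,
        IsKPlex G k (insert v (S.erase u)) ∧
          (insert v (S.erase u)).card = S.card := by
  have hvS : v ∉ S := (Finset.mem_sdiff.mp hv).2
  refine ⟨?_, fun u hu => ?_⟩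
  · by_contra hempty
    rw [Finset.not_nonempty_iff_eq_empty, Finset.sdiff_eq_empty_iff_subset] at hempty
    have hall : S.filter (G.Adj v) = S :=
      Finset.filter_true_of_mem fun w hw => (G.mem_neighborFinset v w).mp (hempty hw)
    rw [hall] at hdeg
    omega
  · obtain ⟨huS, huv⟩ := Finset.mem_sdiff.mp hu
    rw [G.mem_neighborFinset] at huv
    have hcard : (insert v (S.erase u)).card = S.card := by
      rw [Finset.card_insert_of_notMem fun h => hvS (Finset.mem_of_mem_erase h),
        Finset.card_erase_add_one huS]
    refine ⟨fun w hw => ?_, hcard⟩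
    rw [hcard, Finset.filter_insert, Finset.filter_erase]
    rcases Finset.mem_insert.mp hw with rfl | hw
    · rw [if_neg (G.irrefl), Finset.erase_eq_of_notMem fun h => huv (Finset.mem_filter.mp h).2]
      exact hdeg.ge
    · have hwS : w ∈ S := Finset.mem_of_mem_erase hw
      have hw_deg := hS w hwS
      have herase := Finset.pred_card_le_card_erase (s := S.filter (G.Adj w)) (a := u)
      by_cases hwv : G.Adj w v
      · rw [if_pos hwv, Finset.card_insert_of_notMem fun h =>
          hvS (Finset.mem_filter.mp (Finset.mem_of_mem_erase h)).1]
        omega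
      · rw [if_neg hwv]
        have hunsat : ((S.filter (G.Adj w)).card : ℤ) ≠ (S.card : ℤ) - k := fun h =>
          hwv ((G.mem_neighborFinset v w).mp
            (Finset.sdiff_eq_empty_iff_subset.mp hsat (Finset.mem_filter.mpr ⟨hwS, h⟩))).symm
        omega
end

section
/- If S is a k-plex and v ∈ PerturbSet(S) = N(S)∖(AddSet(S) ∪ SwapSet(S)), then S ∪ {v} is not a k-plex; more precisely, there exists a vertex w ∈ (S ∪ {v})∖N(v) with |N(w)∩(S∪{v})| < |S∪{v}|−k (a deficient vertex of S∪{v}). -/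
/-- `SwapSet(S)`. -/
def swapSet {V : Type*} [Fintype V] [DecidableEq V] (G : SimpleGraph V)
    [DecidableRel G.Adj] (k : ℤ) (S : Finset V) : Finset V :=
  (nbrSet G S).filter fun v =>
    (((S.filter (G.Adj v)).card : ℤ) ≥ (S.card : ℤ) - k ∧
        (satSet G k S \ G.neighborFinset v).card = 1) ∨
      (((S.filter (G.Adj v)).card : ℤ) = (S.card : ℤ) - k ∧
        satSet G k S \ G.neighborFinset v = ∅)

/-- `PerturbSet(S)`. -/
def perturbSet {V : Type*} [Fintype V] [DecidableEq V] (G : SimpleGraph V)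
    [DecidableRel G.Adj] (k : ℤ) (S : Finset V) : Finset V :=
  nbrSet G S \ (addSet G k S ∪ swapSet G k S)

/-- Adding a vertex of `PerturbSet(S)` to a `k`-plex `S` never yields a
`k`-plex: some vertex of `(S ∪ {v}) ∖ N(v)` is deficient in `S ∪ {v}`. -/
theorem insert_perturbSet_not_kplex {V : Type*} [Fintype V] [DecidableEq V]
    (G : SimpleGraph V) [DecidableRel G.Adj] (k : ℤ) (hk : 1 ≤ k)
    (S : Finset V) (hS : IsKPlex G k S) (v : V) (hv : v ∈ perturbSet G k S) :
    ¬ IsKPlex G k (insert v S) ∧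
      ∃ w ∈ insert v S \ G.neighborFinset v,
        (((insert v S).filter (G.Adj w)).card : ℤ) <
          ((insert v S).card : ℤ) - k := by
  simp only [perturbSet, addSet, Finset.mem_sdiff, Finset.mem_union, Finset.mem_filter, not_or,
    not_and] at hv
  obtain ⟨hvN, hvA, -⟩ := hv
  have hvS : v ∉ S := (Finset.mem_sdiff.mp hvN).2
  have deficient_of_le : ∀ w, ¬ G.Adj w v →
      ((S.filter (G.Adj w)).card : ℤ) ≤ (S.card : ℤ) - k →
      (((insert v S).filter (G.Adj w)).card : ℤ) < ((insert v S).card : ℤ) - k := by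
    intro w hwv hw
    rw [Finset.filter_insert, if_neg hwv, Finset.card_insert_of_notMem hvS]
    push_cast
    linarith
  have hex : ∃ w ∈ insert v S \ G.neighborFinset v,
      (((insert v S).filter (G.Adj w)).card : ℤ) < ((insert v S).card : ℤ) - k := by
    rcases (satSet G k S \ G.neighborFinset v).eq_empty_or_nonempty with hC | ⟨w, hw⟩
    · refine ⟨v, by simp, deficient_of_le v (G.irrefl) ?_⟩
      by_contra h
      exact hvA hvN (not_le.mp h) hC
    · simp only [satSet, Finset.mem_sdiff, Finset.mem_filter, SimpleGraph.mem_neighborFinset] at hw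
      obtain ⟨⟨hwS, hsat⟩, hvw⟩ := hw
      exact ⟨w, by simp [hwS, hvw], deficient_of_le w (fun h => hvw h.symm) hsat.le⟩
  refine ⟨fun hplex => ?_, hex⟩
  obtain ⟨w, hw, hlt⟩ := hex
  exact absurd (hplex w (Finset.mem_sdiff.mp hw).1) (not_le.mpr hlt)
end

section
/- If S is a k-plex and v ∈ N(S) has at least two saturated non-neighbors in S (|C[S]∖N(v)| ≥ 2), then every vertex w ∈ C[S]∖N(v) is deficient in S ∪ {v}; in particular S ∪ {v} contains at least two deficient vertices, all lying in S∖N(v). -/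
theorem filter_adj_insert_card_lt_of_mem_satSet {V : Type*} [Fintype V] [DecidableEq V]
    (G : SimpleGraph V) [DecidableRel G.Adj] (k : ℤ) {S : Finset V} {v w : V} (hv : v ∉ S)
    (hw : w ∈ satSet G k S \ G.neighborFinset v) :
    (((insert v S).filter (G.Adj w)).card : ℤ) < ((insert v S).card : ℤ) - k := by
  simp only [satSet, Finset.mem_sdiff, Finset.mem_filter, SimpleGraph.mem_neighborFinset] at hw
  obtain ⟨⟨-, hsat⟩, hadj⟩ := hw
  rw [Finset.filter_insert, if_neg fun h => hadj h.symm, Finset.card_insert_of_notMem hv, hsat]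
  push_cast
  linarith

/-- If `v ∈ N(S)` has at least two saturated non-neighbors in a `k`-plex `S`,
then every `w ∈ C[S] ∖ N(v)` is deficient in `S ∪ {v}`; in particular,
`S ∪ {v}` contains at least two deficient vertices lying in `S ∖ N(v)`. -/
theorem two_saturated_nonneighbors_deficient {V : Type*} [Fintype V] [DecidableEq V]
    (G : SimpleGraph V) [DecidableRel G.Adj] (k : ℤ) (hk : 1 ≤ k)
    (S : Finset V) (hS : IsKPlex G k S) (v : V) (hv : v ∈ nbrSet G S)
    (h2 : 2 ≤ (satSet G k S \ G.neighborFinset v).card) :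
    (∀ w ∈ satSet G k S \ G.neighborFinset v,
      (((insert v S).filter (G.Adj w)).card : ℤ) <
        ((insert v S).card : ℤ) - k) ∧
    2 ≤ ((S \ G.neighborFinset v).filter fun w =>
        (((insert v S).filter (G.Adj w)).card : ℤ) <
          ((insert v S).card : ℤ) - k).card := by
  have hvS : v ∉ S := (Finset.mem_sdiff.mp hv).2
  have hdef := fun w hw => filter_adj_insert_card_lt_of_mem_satSet G k (w := w) hvS hw
  refine ⟨hdef, h2.trans (Finset.card_le_card fun w hw => Finset.mem_filter.mpr ⟨?_, hdef w hw⟩)⟩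
  exact Finset.sdiff_subset_sdiff (Finset.filter_subset _ _) subset_rfl hw
end

section
/- Soundness of graph peeling: let G=(V,E) be a finite simple undirected graph, k ≥ 1 and s an integer, and let V' = {v ∈ V : deg_G(v) ≥ s−k+1}. Then every k-plex S of G with |S| > s satisfies S ⊆ V', and S is a k-plex of the induced subgraph G[V']; hence the maximum size of a k-plex of size greater than s is the same in G and in G[V']. -/
instance {V : Type*} (G : SimpleGraph V) [DecidableRel G.Adj] (s : Set V) :
    DecidableRel (G.induce s).Adj := fun a b =>
  inferInstanceAs (Decidable (G.Adj a b))

/-- The image of a set under an induced-subgraph embedding is a `k`-plex iff the set itself is. -/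
theorem isKPlex_map_iff {V W : Type*} [Fintype V] [DecidableEq V] [Fintype W] [DecidableEq W]
    {G : SimpleGraph V} [DecidableRel G.Adj] {H : SimpleGraph W} [DecidableRel H.Adj]
    (f : H ↪g G) (k : ℤ) (S : Finset W) :
    IsKPlex G k (S.map f.toEmbedding) ↔ IsKPlex H k S := by
  have key (w : W) : ((S.map f.toEmbedding).filter (G.Adj (f w))).card =
      (S.filter (H.Adj w)).card := by
    rw [Finset.filter_map, Finset.card_map]
    congr 1
    ext x
    simp
  simp only [IsKPlex, Finset.card_map, Finset.forall_mem_map]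
  exact forall₂_congr fun w _ => by rw [← key w]; rfl

/-- A vertex of a `k`-plex `S` has degree at least `|S| - k`. -/
theorem IsKPlex.card_sub_le_degree {V : Type*} [Fintype V] [DecidableEq V]
    {G : SimpleGraph V} [DecidableRel G.Adj] {k : ℤ} {S : Finset V} (hS : IsKPlex G k S)
    {v : V} (hv : v ∈ S) : (S.card : ℤ) - k ≤ G.degree v := by
  have hle : (S.filter (G.Adj v)).card ≤ G.degree v := by
    rw [← G.card_neighborFinset_eq_degree]
    exact Finset.card_le_card fun x hx => by simpa using (Finset.mem_filter.mp hx).2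
  have := hS v hv
  omega

/-- Soundness of graph peeling: with `V' = {v | deg v ≥ s - k + 1}`, every
`k`-plex of `G` of size greater than `s` lies in `V'` and is a `k`-plex of the
induced subgraph `G[V']`; hence for every size `n > s`, `G` has a `k`-plex of
size `n` iff `G[V']` does, so the maximum size of a `k`-plex of size greater
than `s` is the same in `G` and in `G[V']`. -/
theorem peeling_sound {V : Type*} [Fintype V] [DecidableEq V]
    (G : SimpleGraph V) [DecidableRel G.Adj] (k s : ℤ) (hk : 1 ≤ k) :
    (∀ S : Finset V, IsKPlex G k S → (S.card : ℤ) > s →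
      (∀ v ∈ S, (G.degree v : ℤ) ≥ s - k + 1) ∧
      IsKPlex (G.induce {v : V | (G.degree v : ℤ) ≥ s - k + 1}) k
        (S.subtype fun v => (G.degree v : ℤ) ≥ s - k + 1)) ∧
    (∀ n : ℕ, (n : ℤ) > s →
      ((∃ S : Finset V, IsKPlex G k S ∧ S.card = n) ↔
        (∃ S' : Finset {v : V // (G.degree v : ℤ) ≥ s - k + 1},
          IsKPlex (G.induce {v : V | (G.degree v : ℤ) ≥ s - k + 1}) k S' ∧
            S'.card = n))) := by
  have peel (S : Finset V) (hS : IsKPlex G k S) (hs : (S.card : ℤ) > s) :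
      ∀ v ∈ S, (G.degree v : ℤ) ≥ s - k + 1 := fun v hv => by
    have := hS.card_sub_le_degree hv
    omega
  let f := SimpleGraph.Embedding.induce (G := G) {v : V | (G.degree v : ℤ) ≥ s - k + 1}
  have map_eq (S : Finset V) (hS : ∀ v ∈ S, (G.degree v : ℤ) ≥ s - k + 1) :
      (S.subtype fun v => (G.degree v : ℤ) ≥ s - k + 1).map f.toEmbedding = S :=
    Finset.subtype_map_of_mem hS
  have restrict (S : Finset V) (hS : IsKPlex G k S) (hs : (S.card : ℤ) > s) :
      IsKPlex (G.induce {v : V | (G.degree v : ℤ) ≥ s - k + 1}) k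
        (S.subtype fun v => (G.degree v : ℤ) ≥ s - k + 1) := by
    refine (isKPlex_map_iff f k _).mp ?_
    rwa [map_eq S (peel S hS hs)]
  refine ⟨fun S hS hs => ⟨peel S hS hs, restrict S hS hs⟩, fun n hn => ⟨?_, ?_⟩⟩
  · rintro ⟨S, hS, rfl⟩
    refine ⟨_, restrict S hS hn, ?_⟩
    rw [← Finset.card_map f.toEmbedding, map_eq S (peel S hS hn)]
  · rintro ⟨S, hS, rfl⟩
    exact ⟨S.map f.toEmbedding, (isKPlex_map_iff f k S).mpr hS, Finset.card_map _⟩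
end
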